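/- arXiv:2306.15825 — 4 statements merged into one kernel-verified Lean document; each statement's English description precedes it below -/
import Mathlib

section
/- Let B be a C*-algebra and let a, b ∈ B be selfadjoint elements such that the commutator [a,b] = ab − ba commutes with a. Then [a,b] = 0. -/
open NormedSpace in
/-- If `x` commutes with `x * b - b * x`, then conjugating `b` by `exp (t • x)` adds a term
linear in `t`. -/
theorem exp_smul_mul_mul_exp_smul_neg {A : Type*} [NormedRing A] [NormedAlgebra ℝ A]
    [CompleteSpace A] {x b : A} (h : Commute (x * b - b * x) x) (t : ℝ) :
    exp (t • x) * b * exp (t • (-x)) = b + t • (x * b - b * x) := by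
  have key : ∀ s : ℝ, HasDerivAt
      (fun s : ℝ ↦ exp (s • x) * b * exp (s • (-x)) - s • (x * b - b * x)) 0 s := by
    intro s
    have h₁ := ((hasDerivAt_exp_smul_const x s).mul_const b).mul
      (hasDerivAt_exp_smul_const' (-x) s)
    convert! h₁.sub ((hasDerivAt_id s).smul_const (x * b - b * x)) using 1
    have h₂ : Commute (x * b - b * x) (exp (s • x)) := (h.smul_right s).exp_right
    have h₃ : exp (s • x) * exp (s • (-x)) = 1 := by
      let _ : NormedAlgebra ℚ A := .restrictScalars ℚ ℝ A
      rw [← exp_add_of_commute (((Commute.refl x).neg_right.smul_left s).smul_right s)]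
      simp
    calc (0 : A) = (x * b - b * x) * (exp (s • x) * exp (s • (-x))) - (x * b - b * x) := by
          rw [h₃, mul_one, sub_self]
      _ = exp (s • x) * (x * b - b * x) * exp (s • (-x)) - (x * b - b * x) := by
          rw [← mul_assoc, h₂.eq]
      _ = _ := by simp only [one_smul]; noncomm_ring
  have h₀ := is_const_of_deriv_eq_zero (fun s ↦ (key s).differentiableAt)
    (fun s ↦ (key s).deriv) t 0
  simpa [sub_eq_iff_eq_add] using h₀

theorem eq_zero_of_forall_norm_add_smul_le {E : Type*} [NormedAddCommGroup E] [NormedSpace ℝ E]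
    {b d : E} {C : ℝ} (h : ∀ t : ℝ, ‖b + t • d‖ ≤ C) : d = 0 := by
  by_contra hd
  have hd' : 0 < ‖d‖ := norm_pos_iff.mpr hd
  have hC : 0 ≤ C := (norm_nonneg _).trans (h 0)
  set t : ℝ := (C + ‖b‖ + 1) / ‖d‖ with ht
  have h₁ : ‖t • d‖ = C + ‖b‖ + 1 := by
    rw [norm_smul, Real.norm_of_nonneg (by positivity), ht, div_mul_cancel₀ _ hd'.ne']
  have h₂ : ‖t • d‖ ≤ ‖b + t • d‖ + ‖b‖ := by
    simpa using norm_sub_le (b + t • d) b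
  linarith [h t]

/-- In a unital C*-algebra, a skew-adjoint element which commutes with its commutator with `b`
commutes with `b`. -/
theorem commutator_eq_zero_of_mem_skewAdjoint {A : Type*} [CStarAlgebra A] {x b : A}
    (hx : x ∈ skewAdjoint A) (h : Commute (x * b - b * x) x) : x * b - b * x = 0 := by
  refine eq_zero_of_forall_norm_add_smul_le (b := b) (C := ‖b‖) fun t ↦ ?_
  rw [← exp_smul_mul_mul_exp_smul_neg h t]
  let _ : NormedAlgebra ℚ A := .restrictScalars ℚ ℂ A
  have hu : ∀ s : ℝ, NormedSpace.exp (s • x) ∈ unitary A := fun s ↦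
    NormedSpace.exp_mem_unitary_of_mem_skewAdjoint (skewAdjoint.smul_mem s hx)
  rw [smul_neg, ← neg_smul, CStarRing.norm_mul_mem_unitary _ (hu (-t)),
    CStarRing.norm_mem_unitary_mul _ (hu t)]

/-- If the commutator `[a,b]` of two selfadjoint elements of a C*-algebra commutes with `a`,
then `[a,b] = 0`. -/
theorem commutator_eq_zero_of_commute_selfAdjoint
    (B : Type*) [NonUnitalCStarAlgebra B] (a b : B)
    (ha : IsSelfAdjoint a) (hb : IsSelfAdjoint b)
    (h : Commute (a * b - b * a) a) : a * b - b * a = 0 := by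
  have hskew : Complex.I • (a : Unitization ℂ B) ∈ skewAdjoint (Unitization ℂ B) := by
    rw [skewAdjoint.mem_iff, star_smul, ← Unitization.inr_star, ha.star_eq]
    simp
  have hcomm : Complex.I • (a : Unitization ℂ B) * b - b * Complex.I • (a : Unitization ℂ B) =
      Complex.I • ((a * b - b * a : B) : Unitization ℂ B) := by
    simp [smul_sub]
  have h' : Commute ((a * b - b * a : B) : Unitization ℂ B) (a : Unitization ℂ B) := by
    simpa only [Commute, SemiconjBy, ← Unitization.inr_mul] using
      congrArg (Unitization.inr (R := ℂ)) h.eq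
  have h₀ := commutator_eq_zero_of_mem_skewAdjoint (b := (b : Unitization ℂ B)) hskew
    (by rw [hcomm]; exact (h'.smul_left _).smul_right _)
  rw [hcomm, smul_eq_zero_iff_right Complex.I_ne_zero] at h₀
  exact Unitization.inr_injective (R := ℂ) (by simpa using h₀)
end

section
/- Let B be a C*-algebra such that every commutator [a,b] = ab − ba of selfadjoint elements a, b ∈ B lies in the center of B. Then B is commutative. -/
open scoped ComplexStarModule in
/-- A complex star algebra is commutative as soon as its selfadjoint elements commute. -/
theorem commute_of_isSelfAdjoint_commute {A : Type*} [NonUnitalRing A] [StarRing A]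
    [Module ℂ A] [IsScalarTower ℂ A A] [SMulCommClass ℂ A A] [StarModule ℂ A]
    (h : ∀ a b : A, IsSelfAdjoint a → IsSelfAdjoint b → Commute a b) (x y : A) :
    Commute x y := by
  rw [← realPart_add_I_smul_imaginaryPart x, ← realPart_add_I_smul_imaginaryPart y]
  have hc (a b : selfAdjoint A) : Commute (a : A) b := h a b a.2 b.2
  exact ((hc _ _).add_right ((hc _ _).smul_right _)).add_left
    (((hc _ _).add_right ((hc _ _).smul_right _)).smul_left _)

/-- If the commutators of `b` with `a` and `a * a` are both central, then twice the square of
the former vanishes. -/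
theorem two_nsmul_commutator_mul_self_eq_zero {R : Type*} [NonUnitalRing R] {a b : R}
    (h : ∀ x, Commute (a * b - b * a) x) (h' : Commute (a * a * b - b * (a * a)) b) :
    2 • ((a * b - b * a) * (a * b - b * a)) = 0 := by
  have key : a * a * b - b * (a * a) = 2 • ((a * b - b * a) * a) := by
    have e : a * a * b - b * (a * a) = a * (a * b - b * a) + (a * b - b * a) * a := by
      noncomm_ring
    rw [e, ← (h a).eq, two_nsmul]
  have hb : 2 • ((a * b - b * a) * a * b) = 2 • ((a * b - b * a) * (b * a)) := by
    rw [key] at h'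
    rw [← smul_mul_assoc, h'.eq, mul_smul_comm, ← mul_assoc b, ← (h b).eq, mul_assoc]
  rw [mul_sub, smul_sub, ← mul_assoc, hb, sub_self]

/-- If every commutator of selfadjoint elements of a C*-algebra is central, then the algebra
is commutative. -/
theorem commutative_of_selfAdjoint_commutators_central
    (B : Type*) [NonUnitalCStarAlgebra B]
    (h : ∀ a b : B, IsSelfAdjoint a → IsSelfAdjoint b →
      ∀ x : B, (a * b - b * a) * x = x * (a * b - b * a)) :
    ∀ x y : B, x * y = y * x := by
  refine fun x y ↦ (commute_of_isSelfAdjoint_commute (fun a b ha hb ↦ ?_) x y).eq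
  have haa : IsSelfAdjoint (a * a) := (ha.commute_iff ha).mp (Commute.refl a)
  have hsq := two_nsmul_commutator_mul_self_eq_zero (h a b ha hb) (h (a * a) b haa hb b)
  rw [← Nat.cast_smul_eq_nsmul ℂ, smul_eq_zero_iff_right (by norm_num)] at hsq
  refine sub_eq_zero.mp ((CStarRing.star_mul_self_eq_zero_iff _).mp ?_)
  rw [star_sub, star_mul, star_mul, ha.star_eq, hb.star_eq, ← neg_sub, neg_mul, hsq, neg_zero]
end

section
/- For any C*-algebra A, the Lie algebra su(A) is topologically perfect: su(A) equals the norm closure of [su(A), su(A)], the linear span of commutators of elements of su(A). -/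
noncomputable section

/-- `su(A)`: the norm-closure of the real linear span of commutators of skewadjoint
elements of a (not necessarily unital) C*-algebra. -/
def suAlgN (A : Type*) [NonUnitalCStarAlgebra A] : Submodule ℝ A :=
  (Submodule.span ℝ
    {z : A | ∃ h k : A, star h = -h ∧ star k = -k ∧ z = h * k - k * h}).topologicalClosure

section Semiprime
variable {R : Type*} [NonUnitalRing R]

theorem lie_eq_zero_of_lie_lie_eq_zero (hR : ∀ x : R, (∀ y, x * y * x = 0) → x = 0)
    (h2 : ∀ x : R, x + x = 0 → x = 0) {u : R} (hu : ∀ x : R, ⁅u, ⁅u, x⁆⁆ = 0) (x : R) :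
    ⁅u, x⁆ = 0 := by
  have hprod (x y : R) : ⁅u, x⁆ * ⁅u, y⁆ = 0 := by
    apply h2
    have : ⁅u, ⁅u, x * y⁆⁆ = ⁅u, ⁅u, x⁆⁆ * y + x * ⁅u, ⁅u, y⁆⁆
        + (⁅u, x⁆ * ⁅u, y⁆ + ⁅u, x⁆ * ⁅u, y⁆) := by
      simp only [Ring.lie_def]; noncomm_ring
    simpa [hu] using this.symm
  refine hR _ fun z => ?_
  have : ⁅u, x⁆ * ⁅u, z * x⁆ = ⁅u, x⁆ * z * ⁅u, x⁆ + ⁅u, x⁆ * ⁅u, z⁆ * x := by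
    simp only [Ring.lie_def]; noncomm_ring
  simpa [hprod] using this.symm

/-- A semiprime ring without 2-torsion whose Lie ring is solvable of length 3 is commutative. -/
theorem lie_eq_zero_of_solvable (hR : ∀ x : R, (∀ y, x * y * x = 0) → x = 0)
    (h2 : ∀ x : R, x + x = 0 → x = 0)
    (h : ∀ a b c d a' b' c' d' : R, ⁅⁅⁅a, b⁆, ⁅c, d⁆⁆, ⁅⁅a', b'⁆, ⁅c', d'⁆⁆⁆ = 0) (a b : R) :
    ⁅a, b⁆ = 0 := by
  have key := @lie_eq_zero_of_lie_lie_eq_zero R _ hR h2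
  have hM (a b c d x : R) : ⁅⁅⁅a, b⁆, ⁅c, d⁆⁆, x⁆ = 0 := by
    refine key (fun x => ?_) x
    have : ⁅⁅⁅a, b⁆, ⁅c, d⁆⁆, x⁆ = ⁅⁅⁅a, b⁆, x⁆, ⁅c, d⁆⁆ + ⁅⁅a, b⁆, ⁅⁅c, d⁆, x⁆⁆ := by
      simp only [Ring.lie_def]; noncomm_ring
    rw [this]
    have hadd (p q r : R) : ⁅p, q + r⁆ = ⁅p, q⁆ + ⁅p, r⁆ := by
      simp only [Ring.lie_def]; noncomm_ring
    rw [hadd, h, h, add_zero]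
  have hN (a b x : R) : ⁅⁅a, b⁆, x⁆ = 0 := by
    refine key (fun x => ?_) x
    generalize hn : ⁅a, b⁆ = n
    have hz (x y : R) : ⁅⁅n, ⁅n, x⁆⁆, y⁆ = 0 := by rw [← hn]; exact hM _ _ _ _ _
    have hprod : ⁅n, ⁅n, x⁆⁆ * ⁅n, ⁅n, x⁆⁆ = 0 := by
      have : ⁅⁅n, ⁅n, n * x⁆⁆, ⁅n, x⁆⁆
          = n * ⁅⁅n, ⁅n, x⁆⁆, ⁅n, x⁆⁆ + ⁅n, ⁅n, x⁆⁆ * ⁅n, ⁅n, x⁆⁆ := by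
        simp only [Ring.lie_def]; noncomm_ring
      simpa [hz] using this.symm
    refine hR _ fun y => ?_
    have hc : ⁅n, ⁅n, x⁆⁆ * y = y * ⁅n, ⁅n, x⁆⁆ := sub_eq_zero.mp (hz x y)
    rw [hc, mul_assoc, hprod, mul_zero]
  exact key (fun x => by
    have : ⁅a, ⁅a, x⁆⁆ = -⁅⁅a, x⁆, a⁆ := by simp only [Ring.lie_def]; noncomm_ring
    rw [this, hN, neg_zero]) b
end Semiprime

section Ideal
open Filter Topology
variable {A : Type*} [NonUnitalCStarAlgebra A]

theorem exists_filter_approximateUnit (J : NonUnitalStarSubalgebra ℂ A)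
    (hJ : IsClosed (J : Set A)) :
    ∃ l : Filter A, l.NeBot ∧ (∀ᶠ e in l, e ∈ J ∧ star e = e ∧ ‖e‖ ≤ 1) ∧
      ∀ x ∈ J, Tendsto (fun e => e * x) l (𝓝 x) := by
  have : IsClosed (J : Set A) := hJ
  let _ := CStarAlgebra.spectralOrder J
  let _ := CStarAlgebra.spectralOrderedRing J
  have hl := CStarAlgebra.increasingApproximateUnit J
  refine ⟨(CStarAlgebra.approximateUnit J).map (Subtype.val), inferInstance, ?_, ?_⟩
  · rw [eventually_map]
    filter_upwards [hl.eventually_norm, hl.eventually_star_eq] with e h1 h2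
    exact ⟨e.2, congrArg Subtype.val h2, h1⟩
  · intro x hx
    rw [tendsto_map'_iff]
    exact (continuous_subtype_val.tendsto _).comp (hl.tendsto_mul_right ⟨x, hx⟩)

theorem mem_of_star_mul_self_mem (J : NonUnitalStarSubalgebra ℂ A)
    (hJ : IsClosed (J : Set A)) (hl : ∀ a : A, ∀ x ∈ J, a * x ∈ J) {x : A}
    (hx : star x * x ∈ J) : x ∈ J := by
  obtain ⟨l, _, h1, h2⟩ := exists_filter_approximateUnit J hJ
  have ht : Tendsto (fun e => x * e) l (𝓝 x) := by
    have h0 : Tendsto (fun e => 2 * ‖star x * x - e * (star x * x)‖) l (𝓝 0) := by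
      simpa using (((tendsto_const_nhds (x := star x * x)).sub (h2 _ hx)).norm).const_mul 2
    have h3 : Tendsto (fun e => ‖x * e - x‖ * ‖x * e - x‖) l (𝓝 0) := by
      refine squeeze_zero' (.of_forall fun _ => by positivity) ?_ h0
      filter_upwards [h1] with e he
      rw [← CStarRing.norm_star_mul_self]
      have : star (x * e - x) * (x * e - x) = (star x * x - e * (star x * x))
          - (star x * x - e * (star x * x)) * e := by
        rw [star_sub, star_mul, he.2.1]; noncomm_ring
      rw [this, two_mul]
      refine (norm_sub_le _ _).trans (add_le_add_right ((norm_mul_le _ _).trans ?_) _)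
      exact mul_le_of_le_one_right (norm_nonneg _) he.2.2
    rw [tendsto_iff_norm_sub_tendsto_zero]
    have := h3.sqrt
    simpa [Real.sqrt_mul_self] using this
  exact hJ.mem_of_tendsto ht (h1.mono fun e he => hl _ _ he.1)

theorem mem_of_forall_mul_mul_mem (J : NonUnitalStarSubalgebra ℂ A)
    (hJ : IsClosed (J : Set A)) (hl : ∀ a : A, ∀ x ∈ J, a * x ∈ J) {x : A}
    (hx : ∀ y, x * y * x ∈ J) : x ∈ J := by
  apply mem_of_star_mul_self_mem J hJ hl
  apply mem_of_star_mul_self_mem J hJ hl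
  have : star (star x * x) * (star x * x) = star x * (x * star x * x) := by
    rw [star_mul, star_star]; noncomm_ring
  rw [this]
  exact hl _ _ (hx _)

theorem lie_mem_of_solvable (J : NonUnitalStarSubalgebra ℂ A)
    (hJ : IsClosed (J : Set A)) (hl : ∀ a : A, ∀ x ∈ J, a * x ∈ J)
    (hr : ∀ a : A, ∀ x ∈ J, x * a ∈ J)
    (h : ∀ a b c d a' b' c' d' : A, ⁅⁅⁅a, b⁆, ⁅c, d⁆⁆, ⁅⁅a', b'⁆, ⁅c', d'⁆⁆⁆ ∈ J) (a b : A) :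
    ⁅a, b⁆ ∈ J := by
  let I : TwoSidedIdeal A := TwoSidedIdeal.mk' J J.zero_mem J.add_mem J.neg_mem
    (fun {x y} hy => hl x y hy) (fun {x y} hx => hr y x hx)
  let π : A →ₙ+* I.ringCon.Quotient :=
    { toFun := fun x => x
      map_mul' := fun _ _ => rfl
      map_zero' := rfl
      map_add' := fun _ _ => rfl }
  have hI (x : A) : x ∈ J ↔ π x = 0 := by
    have h1 : x ∈ I ↔ x ∈ J := TwoSidedIdeal.mem_mk' ..
    rw [← h1, TwoSidedIdeal.mem_iff]
    exact (RingCon.eq _).symm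
  have hs : Function.Surjective π := Quotient.mk_surjective
  have hmap (x y : A) : π ⁅x, y⁆ = ⁅π x, π y⁆ := by
    simp only [Ring.lie_def, map_sub, map_mul]
  rw [hI, hmap]
  refine lie_eq_zero_of_solvable ?_ ?_ ?_ _ _
  · intro x hx
    obtain ⟨x, rfl⟩ := hs x
    rw [← hI]
    refine mem_of_forall_mul_mul_mem J hJ hl fun y => ?_
    rw [hI, map_mul, map_mul, hx]
  · intro x hx
    obtain ⟨x, rfl⟩ := hs x
    rw [← map_add, ← hI] at hx
    rw [← hI]
    have : x = (1 / 2 : ℂ) • (x + x) := by module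
    rw [this]
    exact J.smul_mem _ hx
  · intro a b c d a' b' c' d'
    obtain ⟨a, rfl⟩ := hs a
    obtain ⟨b, rfl⟩ := hs b
    obtain ⟨c, rfl⟩ := hs c
    obtain ⟨d, rfl⟩ := hs d
    obtain ⟨a', rfl⟩ := hs a'
    obtain ⟨b', rfl⟩ := hs b'
    obtain ⟨c', rfl⟩ := hs c'
    obtain ⟨d', rfl⟩ := hs d'
    simp only [← hmap]
    rw [← hI]
    exact h ..

/-- Averages of an approximate unit are asymptotically central. -/
theorem exists_almost_central_average (J : NonUnitalStarSubalgebra ℂ A)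
    (hJ : IsClosed (J : Set A)) (hl : ∀ a : A, ∀ x ∈ J, a * x ∈ J)
    (hr : ∀ a : A, ∀ x ∈ J, x * a ∈ J) {c : A} (hc : c ∈ J) (b : A) {δ : ℝ} (hδ : 0 < δ)
    (n : ℕ) :
    ∃ e ∈ J, ‖e * c - n • c‖ ≤ n * δ ∧ ‖⁅e, b⁆‖ ^ 2 ≤ n * ((2 * ‖b‖) ^ 2 + 1) := by
  induction n with
  | zero => exact ⟨0, J.zero_mem, by simp, by simp [Ring.lie_def]⟩
  | succ n ih =>
    obtain ⟨f, hf, hf1, hf2⟩ := ih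
    obtain ⟨l, _, h1, h2⟩ := exists_filter_approximateUnit J hJ
    have hfb : ⁅f, b⁆ ∈ J := J.sub_mem (hr _ _ hf) (hl _ _ hf)
    have ht : Tendsto (fun e => 2 * ‖star b * (e * ⁅f, b⁆) - e * (star b * ⁅f, b⁆)‖) l (𝓝 0) := by
      simpa using ((((h2 _ hfb).const_mul (star b)).sub (h2 _ (hl (star b) _ hfb))).norm).const_mul 2
    have hc' : Tendsto (fun e => ‖e * c - c‖) l (𝓝 0) :=
      tendsto_iff_norm_sub_tendsto_zero.mp (h2 c hc)
    obtain ⟨e, ⟨he, hes, hen⟩, he1, he2⟩ :=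
      (h1.and ((ht.eventually_lt_const one_pos).and (hc'.eventually_lt_const hδ))).exists
    refine ⟨f + e, J.add_mem hf he, ?_, ?_⟩
    · have : (f + e) * c - (n + 1) • c = (f * c - n • c) + (e * c - c) := by
        rw [add_mul, succ_nsmul]; abel
      rw [this]
      push_cast
      linarith [norm_add_le (f * c - n • c) (e * c - c)]
    · have hs : ⁅f + e, b⁆ = ⁅f, b⁆ + ⁅e, b⁆ := by simp only [Ring.lie_def]; noncomm_ring
      have hstar : star ⁅e, b⁆ = star b * e - e * star b := by
        simp [Ring.lie_def, hes]
      have hcross : ‖star ⁅e, b⁆ * ⁅f, b⁆‖ < 1 / 2 := by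
        have : star ⁅e, b⁆ * ⁅f, b⁆ = star b * (e * ⁅f, b⁆) - e * (star b * ⁅f, b⁆) := by
          rw [hstar]; noncomm_ring
        rw [this]; linarith
      have hcross' : ‖star ⁅f, b⁆ * ⁅e, b⁆‖ < 1 / 2 := by
        rw [← norm_star, star_mul, star_star]; exact hcross
      have hb : ‖⁅e, b⁆‖ ≤ 2 * ‖b‖ := by
        have h3 := norm_mul_le e b
        have h4 := norm_mul_le b e
        have h5 := norm_sub_le (e * b) (b * e)
        rw [Ring.lie_def]
        nlinarith [norm_nonneg b, norm_nonneg e]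
      have hb2 : ‖⁅e, b⁆‖ ^ 2 ≤ (2 * ‖b‖) ^ 2 := by gcongr
      have hexp : star (⁅f, b⁆ + ⁅e, b⁆) * (⁅f, b⁆ + ⁅e, b⁆) = star ⁅f, b⁆ * ⁅f, b⁆
          + star ⁅e, b⁆ * ⁅e, b⁆ + (star ⁅f, b⁆ * ⁅e, b⁆ + star ⁅e, b⁆ * ⁅f, b⁆) := by
        rw [star_add]; noncomm_ring
      rw [hs, sq, ← CStarRing.norm_star_mul_self, hexp]
      refine (norm_add₃_le).trans ?_
      rw [CStarRing.norm_star_mul_self, CStarRing.norm_star_mul_self]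
      have := norm_add_le (star ⁅f, b⁆ * ⁅e, b⁆) (star ⁅e, b⁆ * ⁅f, b⁆)
      push_cast
      nlinarith

theorem lie_mem_of_lie_mem_ideal (J : NonUnitalStarSubalgebra ℂ A)
    (hJ : IsClosed (J : Set A)) (hl : ∀ a : A, ∀ x ∈ J, a * x ∈ J)
    (hr : ∀ a : A, ∀ x ∈ J, x * a ∈ J) (M : Submodule ℂ A) (hM : IsClosed (M : Set A))
    (hJM : ∀ x ∈ J, ∀ a : A, ⁅x, a⁆ ∈ M) {a b : A} (hab : ⁅a, b⁆ ∈ J) : ⁅a, b⁆ ∈ M := by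
  choose e he he1 he2 using fun n : ℕ => exists_almost_central_average J hJ hl hr hab b
    (Nat.one_div_pos_of_nat (α := ℝ) (n := n)) (n + 1)
  let K : ℝ := (2 * ‖b‖) ^ 2 + 1
  have hK : 0 ≤ K := by positivity
  have ht : Tendsto (fun n : ℕ => ((n + 1 : ℕ) : ℂ)⁻¹ • ⁅e n * a, b⁆) atTop (𝓝 ⁅a, b⁆) := by
    rw [tendsto_iff_norm_sub_tendsto_zero]
    have h0 : Tendsto (fun n : ℕ => 1 / ((n : ℝ) + 1) + √(K * (1 / ((n : ℝ) + 1))) * ‖a‖)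
        atTop (𝓝 0) := by
      have h := tendsto_one_div_add_atTop_nhds_zero_nat (𝕜 := ℝ)
      simpa using h.add (((h.const_mul K).sqrt).mul_const ‖a‖)
    refine squeeze_zero (fun _ => norm_nonneg _) (fun n => ?_) h0
    have hn : (0 : ℝ) < n + 1 := by positivity
    have hn' : ((n + 1 : ℕ) : ℂ) ≠ 0 := by exact_mod_cast n.succ_ne_zero
    have hnorm : ‖((n + 1 : ℕ) : ℂ)⁻¹‖ = 1 / ((n : ℝ) + 1) := by
      rw [norm_inv, Complex.norm_natCast, one_div]; push_cast; rfl
    have hid : ((n + 1 : ℕ) : ℂ)⁻¹ • ⁅e n * a, b⁆ - ⁅a, b⁆ = ((n + 1 : ℕ) : ℂ)⁻¹ •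
        ((e n * ⁅a, b⁆ - (n + 1) • ⁅a, b⁆) + ⁅e n, b⁆ * a) := by
      have h3 : ⁅e n * a, b⁆ = e n * ⁅a, b⁆ + ⁅e n, b⁆ * a := by
        simp only [Ring.lie_def]; noncomm_ring
      have h4 : ((n + 1 : ℕ) : ℂ)⁻¹ • ((n + 1) • ⁅a, b⁆) = ⁅a, b⁆ := by
        rw [← Nat.cast_smul_eq_nsmul ℂ, inv_smul_smul₀ hn']
      rw [h3, sub_add_eq_add_sub, smul_sub, h4]
    rw [hid, norm_smul, hnorm]
    have hs : ‖⁅e n, b⁆‖ ≤ √((n + 1) * K) := by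
      apply Real.le_sqrt_of_sq_le
      simpa using he2 n
    have hs' : 1 / ((n : ℝ) + 1) * √((n + 1) * K) = √(K * (1 / ((n : ℝ) + 1))) := by
      rw [← Real.sqrt_sq (by positivity : 0 ≤ 1 / ((n : ℝ) + 1)), ← Real.sqrt_mul (by positivity),
        Real.sqrt_sq (by positivity : 0 ≤ 1 / ((n : ℝ) + 1))]
      congr 1; field_simp
    calc 1 / ((n : ℝ) + 1) * ‖(e n * ⁅a, b⁆ - (n + 1) • ⁅a, b⁆) + ⁅e n, b⁆ * a‖
        ≤ 1 / ((n : ℝ) + 1) * (((n + 1 : ℕ) : ℝ) * (1 / ((n : ℝ) + 1)) + √((n + 1) * K) * ‖a‖) := by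
          gcongr
          refine (norm_add_le _ _).trans (add_le_add (he1 n) ((norm_mul_le _ _).trans ?_))
          gcongr
      _ = _ := by
          rw [mul_add, ← mul_assoc _ _ ‖a‖, hs']
          push_cast
          field_simp
  exact hM.mem_of_tendsto ht (.of_forall fun n => M.smul_mem _ (hJM _ (hr _ _ (he n)) _))

theorem lie_mem_of_isClosed_lieIdeal (M : Submodule ℂ A) (hM : IsClosed (M : Set A))
    (hstar : ∀ x ∈ M, star x ∈ M) (hlie : ∀ x ∈ M, ∀ a : A, ⁅x, a⁆ ∈ M)
    (hder : ∀ a b c d : A, ⁅⁅a, b⁆, ⁅c, d⁆⁆ ∈ M) (a b : A) : ⁅a, b⁆ ∈ M := by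
  have hneg (x y : A) : ⁅x, y⁆ = -⁅y, x⁆ := by simp only [Ring.lie_def]; noncomm_ring
  have hmul {x y : A} (hx : ∀ a, ⁅x, a⁆ ∈ M) (hy : ∀ a, ⁅y, a⁆ ∈ M) (a : A) :
      ⁅x * y, a⁆ ∈ M := by
    have : ⁅x * y, a⁆ = ⁅x, y * a⁆ + ⁅y, a * x⁆ := by simp only [Ring.lie_def]; noncomm_ring
    rw [this]
    exact M.add_mem (hx _) (hy _)
  have hbr {x : A} (hx : ∀ a, ⁅x, a⁆ ∈ M) (y a : A) : ⁅⁅x, y⁆, a⁆ ∈ M := hlie _ (hx y) a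
  have hadd {x y : A} (hx : ∀ a, ⁅x, a⁆ ∈ M) (hy : ∀ a, ⁅y, a⁆ ∈ M) (a : A) :
      ⁅x + y, a⁆ ∈ M := by
    have : ⁅x + y, a⁆ = ⁅x, a⁆ + ⁅y, a⁆ := by simp only [Ring.lie_def]; noncomm_ring
    rw [this]
    exact M.add_mem (hx _) (hy _)
  have hst {x : A} (hx : ∀ a, ⁅x, a⁆ ∈ M) (a : A) : ⁅star x, a⁆ ∈ M := by
    have : ⁅star x, a⁆ = -star ⁅x, star a⁆ := by
      simp only [Ring.lie_def, star_sub, star_mul, star_star]; noncomm_ring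
    rw [this]
    exact M.neg_mem (hstar _ (hx _))
  have hleft {x : A} (hx : ∀ a, ⁅x, a⁆ ∈ M) (hx' : ∀ a c, ⁅x * a, c⁆ ∈ M) (y c : A) :
      ⁅y * x, c⁆ ∈ M := by
    have : y * x = -⁅x, y⁆ + x * y := by simp only [Ring.lie_def]; noncomm_ring
    rw [this]
    refine hadd (fun a => ?_) (hx' y) c
    have : ⁅-⁅x, y⁆, a⁆ = -⁅⁅x, y⁆, a⁆ := by simp only [Ring.lie_def]; noncomm_ring
    rw [this]
    exact M.neg_mem (hbr hx _ _)
  have hright {x : A} (hx' : ∀ a c, ⁅x * a, c⁆ ∈ M) (y a c : A) : ⁅x * y * a, c⁆ ∈ M := by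
    rw [mul_assoc]; exact hx' _ _
  have hlr {x : A} (hx' : ∀ a c, ⁅x * a, c⁆ ∈ M) (y a c : A) : ⁅y * x * a, c⁆ ∈ M := by
    rw [mul_assoc]; exact hleft (hx' a) (hright hx' a) y c
  let J : NonUnitalStarSubalgebra ℂ A :=
    { carrier := {x | (∀ a, ⁅x, a⁆ ∈ M) ∧ ∀ a c, ⁅x * a, c⁆ ∈ M}
      zero_mem' := by simp [Ring.lie_def]
      add_mem' := fun {x y} hx hy =>
        ⟨hadd hx.1 hy.1, fun a c => by rw [add_mul]; exact hadd (hx.2 a) (hy.2 a) c⟩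
      mul_mem' := fun {x y} hx hy => ⟨hx.2 y, hright hx.2 y⟩
      smul_mem' := fun z x hx => by
        have h1 (x a : A) : ⁅z • x, a⁆ = z • ⁅x, a⁆ := by
          simp only [Ring.lie_def, smul_mul_assoc, mul_smul_comm, smul_sub]
        refine ⟨fun a => ?_, fun a c => ?_⟩
        · rw [h1]; exact M.smul_mem _ (hx.1 a)
        · rw [smul_mul_assoc, h1]; exact M.smul_mem _ (hx.2 a c)
      star_mem' := fun {x} hx => by
        refine ⟨hst hx.1, fun a => ?_⟩
        have : star x * a = star (star a * x) := by rw [star_mul, star_star]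
        rw [this]
        exact hst (hleft hx.1 hx.2 _) }
  have hJ : IsClosed (J : Set A) := by
    have : (J : Set A) = (⋂ a : A, {x | x * a - a * x ∈ (M : Set A)}) ∩
        ⋂ a : A, ⋂ c : A, {x | x * a * c - c * (x * a) ∈ (M : Set A)} := by
      ext x
      simp only [Set.mem_inter_iff, Set.mem_iInter, Set.mem_ofPred_eq]
      rfl
    rw [this]
    refine (isClosed_iInter fun a => hM.preimage (by fun_prop)).inter
      (isClosed_iInter fun a => isClosed_iInter fun c => hM.preimage (by fun_prop))
  have hJl (a : A) (x : A) (hx : x ∈ J) : a * x ∈ J := ⟨hleft hx.1 hx.2 a, hlr hx.2 a⟩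
  have hJr (a : A) (x : A) (hx : x ∈ J) : x * a ∈ J := ⟨hx.2 a, hright hx.2 a⟩
  have hlieJ {u v : A} (hu : ∀ a, ⁅u, a⁆ ∈ M) (hv : ∀ a, ⁅v, a⁆ ∈ M) : ⁅u, v⁆ ∈ J := by
    refine ⟨hbr hu v, fun a c => ?_⟩
    have : ⁅u, v⁆ * a = ⁅u, v * a⁆ + v * ⁅a, u⁆ := by simp only [Ring.lie_def]; noncomm_ring
    rw [this]
    refine hadd (hbr hu _) (hmul hv fun c => ?_) c
    refine hlie _ ?_ c
    rw [hneg]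
    exact M.neg_mem (hu a)
  refine lie_mem_of_lie_mem_ideal J hJ hJl hJr M hM (fun x hx => hx.1) ?_
  exact lie_mem_of_solvable J hJ hJl hJr
    (fun a b c d a' b' c' d' => hlieJ (hlie _ (hder a b c d)) (hlie _ (hder a' b' c' d'))) a b

/-- Every commutator is a limit of linear combinations of commutators of commutators. -/
theorem lie_mem_topologicalClosure_span_lie_lie (a b : A) :
    ⁅a, b⁆ ∈ (Submodule.span ℂ
      {z : A | ∃ a b c d : A, z = ⁅⁅a, b⁆, ⁅c, d⁆⁆}).topologicalClosure := by
  set S := {z : A | ∃ a b c d : A, z = ⁅⁅a, b⁆, ⁅c, d⁆⁆}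
  have hstarS : ∀ x ∈ Submodule.span ℂ S, star x ∈ Submodule.span ℂ S := by
    intro x hx
    induction hx using Submodule.span_induction with
    | mem x hx =>
      obtain ⟨a, b, c, d, rfl⟩ := hx
      refine Submodule.subset_span ⟨star d, star c, star b, star a, ?_⟩
      simp only [Ring.lie_def, star_sub, star_mul]
    | zero => simp
    | add x y _ _ hx hy => rw [star_add]; exact add_mem hx hy
    | smul c x _ hx => rw [star_smul]; exact Submodule.smul_mem _ _ hx
  have hlieS (a : A) : ∀ x ∈ Submodule.span ℂ S, ⁅x, a⁆ ∈ Submodule.span ℂ S := by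
    intro x hx
    induction hx using Submodule.span_induction with
    | mem x hx =>
      obtain ⟨p, q, r, s, rfl⟩ := hx
      have : ⁅⁅⁅p, q⁆, ⁅r, s⁆⁆, a⁆ = ⁅⁅⁅p, q⁆, a⁆, ⁅r, s⁆⁆ + ⁅⁅p, q⁆, ⁅⁅r, s⁆, a⁆⁆ := by
        simp only [Ring.lie_def]; noncomm_ring
      rw [this]
      exact add_mem (Submodule.subset_span ⟨_, _, _, _, rfl⟩)
        (Submodule.subset_span ⟨_, _, _, _, rfl⟩)
    | zero => simp [Ring.lie_def]
    | add x y _ _ hx hy =>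
      have : ⁅x + y, a⁆ = ⁅x, a⁆ + ⁅y, a⁆ := by simp only [Ring.lie_def]; noncomm_ring
      rw [this]; exact add_mem hx hy
    | smul c x _ hx =>
      have : ⁅c • x, a⁆ = c • ⁅x, a⁆ := by
        simp only [Ring.lie_def, smul_mul_assoc, mul_smul_comm, smul_sub]
      rw [this]; exact Submodule.smul_mem _ _ hx
  refine lie_mem_of_isClosed_lieIdeal _ (Submodule.isClosed_topologicalClosure _) ?_ ?_ ?_ a b
  · exact fun x hx => map_mem_closure continuous_star hx hstarS
  · refine fun x hx a => map_mem_closure (f := fun x => ⁅x, a⁆) ?_ hx (hlieS a)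
    simp only [Ring.lie_def]
    fun_prop
  · exact fun a b c d => subset_closure (Submodule.subset_span ⟨a, b, c, d, rfl⟩)

end Ideal

section Skew
open Complex

variable {A : Type*} [NonUnitalCStarAlgebra A]

theorem exists_skew_decomposition (a : A) :
    ∃ x y : A, star x = -x ∧ star y = -y ∧ a = x + I • y := by
  refine ⟨(1 / 2 : ℂ) • (a - star a), (-I / 2 : ℂ) • (a + star a), ?_, ?_, ?_⟩
  · simp only [star_smul, star_sub, star_star, ← smul_neg, neg_sub]
    simp
  · simp only [star_smul, star_add, star_star, ← neg_smul]
    rw [add_comm]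
    congr 1
    simp [neg_div]
  · have h : I * (-I / 2) = 1 / 2 := by linear_combination (-1 / 2 : ℂ) * I_mul_I
    rw [smul_smul, h]
    module

theorem lie_mem_suAlgN {h k : A} (hh : star h = -h) (hk : star k = -k) : ⁅h, k⁆ ∈ suAlgN A :=
  subset_closure (Submodule.subset_span ⟨h, k, hh, hk, rfl⟩)

theorem star_eq_neg_of_mem_suAlgN {x : A} (hx : x ∈ suAlgN A) : star x = -x := by
  have hc : IsClosed {x : A | star x = -x} := isClosed_eq continuous_star continuous_neg
  refine closure_minimal (fun x (hx : x ∈ Submodule.span ℝ _) => ?_) hc hx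
  change star x = -x
  induction hx using Submodule.span_induction with
  | mem x hx =>
    obtain ⟨h, k, hh, hk, rfl⟩ := hx
    simp [hh, hk]
  | zero => simp
  | add x y _ _ hx hy => rw [star_add, hx, hy, neg_add]
  | smul c x _ hx => rw [star_smul, hx, smul_neg, star_trivial]

theorem lie_add_I_smul (a₁ a₂ b₁ b₂ : A) :
    ⁅a₁ + I • a₂, b₁ + I • b₂⁆ = ⁅a₁, b₁⁆ - ⁅a₂, b₂⁆ + I • (⁅a₁, b₂⁆ + ⁅a₂, b₁⁆) := by
  have hI (x : A) : I • I • x = -x := by rw [smul_smul, I_mul_I, neg_one_smul]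
  simp only [Ring.lie_def, add_mul, mul_add, smul_mul_assoc, mul_smul_comm, smul_add, hI]
  module

theorem exists_lie_eq_suAlgN (a b : A) :
    ∃ x ∈ suAlgN A, ∃ y ∈ suAlgN A, ⁅a, b⁆ = x + I • y := by
  obtain ⟨a₁, a₂, ha₁, ha₂, rfl⟩ := exists_skew_decomposition a
  obtain ⟨b₁, b₂, hb₁, hb₂, rfl⟩ := exists_skew_decomposition b
  refine ⟨⁅a₁, b₁⁆ - ⁅a₂, b₂⁆, sub_mem (lie_mem_suAlgN ha₁ hb₁) (lie_mem_suAlgN ha₂ hb₂),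
    ⁅a₁, b₂⁆ + ⁅a₂, b₁⁆, add_mem (lie_mem_suAlgN ha₁ hb₂) (lie_mem_suAlgN ha₂ hb₁), ?_⟩
  exact lie_add_I_smul a₁ a₂ b₁ b₂

/-- The skewadjoint part of a commutator of commutators lies in `[su(A), su(A)]`. -/
theorem sub_star_mem_span_lie_suAlgN {z : A}
    (hz : z ∈ Submodule.span ℂ {z : A | ∃ a b c d : A, z = ⁅⁅a, b⁆, ⁅c, d⁆⁆}) :
    z - star z ∈
      Submodule.span ℝ {z : A | ∃ x ∈ suAlgN A, ∃ y ∈ suAlgN A, z = x * y - y * x} := by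
  set P := Submodule.span ℝ {z : A | ∃ x ∈ suAlgN A, ∃ y ∈ suAlgN A, z = x * y - y * x}
  have hP {x y : A} (hx : x ∈ suAlgN A) (hy : y ∈ suAlgN A) : ⁅x, y⁆ ∈ P :=
    Submodule.subset_span ⟨x, hx, y, hy, rfl⟩
  rw [← one_smul ℂ z]
  generalize (1 : ℂ) = c
  induction hz using Submodule.span_induction generalizing c with
  | mem z hz =>
    obtain ⟨a, b, p, q, rfl⟩ := hz
    have : c • ⁅⁅a, b⁆, ⁅p, q⁆⁆ = ⁅⁅c • a, b⁆, ⁅p, q⁆⁆ := by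
      simp only [Ring.lie_def, smul_mul_assoc, mul_smul_comm, ← smul_sub]
    rw [this]
    obtain ⟨x₁, hx₁, x₂, hx₂, hx⟩ := exists_lie_eq_suAlgN (c • a) b
    obtain ⟨y₁, hy₁, y₂, hy₂, hy⟩ := exists_lie_eq_suAlgN p q
    rw [hx, hy, lie_add_I_smul]
    have hu : ⁅x₁, y₁⁆ - ⁅x₂, y₂⁆ ∈ P := sub_mem (hP hx₁ hy₁) (hP hx₂ hy₂)
    have hskew {x y : A} (hx : x ∈ suAlgN A) (hy : y ∈ suAlgN A) : star ⁅x, y⁆ = -⁅x, y⁆ := by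
      simp [Ring.lie_def, star_eq_neg_of_mem_suAlgN hx, star_eq_neg_of_mem_suAlgN hy]
    have : ⁅x₁, y₁⁆ - ⁅x₂, y₂⁆ + I • (⁅x₁, y₂⁆ + ⁅x₂, y₁⁆) -
        star (⁅x₁, y₁⁆ - ⁅x₂, y₂⁆ + I • (⁅x₁, y₂⁆ + ⁅x₂, y₁⁆)) =
        (⁅x₁, y₁⁆ - ⁅x₂, y₂⁆) + (⁅x₁, y₁⁆ - ⁅x₂, y₂⁆) := by
      simp only [star_add, star_sub, star_smul, hskew hx₁ hy₁, hskew hx₂ hy₂, hskew hx₁ hy₂,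
        hskew hx₂ hy₁, star_def, conj_I]
      module
    rw [this]
    exact add_mem hu hu
  | zero => simp
  | add x y _ _ hx hy =>
    have : c • (x + y) - star (c • (x + y)) = (c • x - star (c • x)) + (c • y - star (c • y)) := by
      rw [smul_add, star_add]; abel
    rw [this]; exact add_mem (hx c) (hy c)
  | smul d x _ hx => rw [smul_smul]; exact hx _

end Skew

/-- `su(A)` is topologically perfect: it equals the closure of the linear span of commutators
of its own elements. -/
theorem suAlg_topologically_perfect (A : Type*) [NonUnitalCStarAlgebra A] :
    (suAlgN A : Set A) = closure
      ↑(Submodule.span ℝ {z : A | ∃ x ∈ suAlgN A, ∃ y ∈ suAlgN A, z = x * y - y * x}) := by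
  refine (closure_minimal (fun z hz => ?_) isClosed_closure).antisymm
    (closure_minimal (fun z hz => ?_) (Submodule.isClosed_topologicalClosure _))
  · set P := Submodule.span ℝ {z : A | ∃ x ∈ suAlgN A, ∃ y ∈ suAlgN A, z = x * y - y * x}
    refine (Submodule.span_le (p := P.topologicalClosure)).mpr ?_ hz
    rintro _ ⟨h, k, hh, hk, rfl⟩
    have hcl : ⁅h, k⁆ - star ⁅h, k⁆ ∈ P.topologicalClosure :=
      map_mem_closure (f := fun z : A => z - star z) (by fun_prop)
        (lie_mem_topologicalClosure_span_lie_lie h k) fun z hz => sub_star_mem_span_lie_suAlgN hz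
    have : h * k - k * h = (1 / 2 : ℝ) • (⁅h, k⁆ - star ⁅h, k⁆) := by
      rw [star_eq_neg_of_mem_suAlgN (lie_mem_suAlgN hh hk), Ring.lie_def]
      module
    rw [this]
    exact Submodule.smul_mem _ _ hcl
  · refine (Submodule.span_le (p := suAlgN A)).mpr ?_ hz
    rintro _ ⟨x, hx, y, hy, rfl⟩
    exact lie_mem_suAlgN (star_eq_neg_of_mem_suAlgN hx) (star_eq_neg_of_mem_suAlgN hy)
end
end

section
/- Let A be a unital C*-algebra, and let M be the additive group generated by the set {a² : a ∈ [A_sa,A_sa]} (equivalently, the additive group generated by Jordan products a∘b = ab + ba with a, b ∈ [A_sa,A_sa]). Then [M, iA_sa] ⊆ M; consequently L := M + iM satisfies [L, A] ⊆ L, i.e., L is a Lie ideal of A. -/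
noncomputable section

/-- `[A_sa, A_sa]`: the real linear span of commutators of selfadjoint elements. -/
def commSA (A : Type*) [CStarAlgebra A] : Submodule ℝ A :=
  Submodule.span ℝ
    {z : A | ∃ a b : A, IsSelfAdjoint a ∧ IsSelfAdjoint b ∧ z = a * b - b * a}

/-- `M`: the additive group generated by squares of elements of `[A_sa, A_sa]`. -/
def Msub (A : Type*) [CStarAlgebra A] : AddSubgroup A :=
  AddSubgroup.closure {x : A | ∃ a ∈ commSA A, x = a ^ 2}

/-- `L = M + iM`. -/
def Lset (A : Type*) [CStarAlgebra A] : Set A :=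
  {x : A | ∃ m ∈ Msub A, ∃ m' ∈ Msub A, x = m + Complex.I • m'}

/-- `[A_sa, A_sa]` is stable under commutation with skew-adjoint elements. -/
theorem commSA_bracket_skew {A : Type*} [CStarAlgebra A] {a b : A} (ha : a ∈ commSA A)
    (hb : star b = -b) : a * b - b * a ∈ commSA A := by
  have bracket_sa {x : A} (hx : IsSelfAdjoint x) : IsSelfAdjoint (x * b - b * x) := by
    simp only [IsSelfAdjoint, star_sub, star_mul, hb, hx.star_eq]
    noncomm_ring
  unfold commSA at ha
  induction ha using Submodule.span_induction with
  | mem z hz =>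
    obtain ⟨x, y, hx, hy, rfl⟩ := hz
    have jacobi : (x * y - y * x) * b - b * (x * y - y * x) =
        ((x * b - b * x) * y - y * (x * b - b * x)) +
          (x * (y * b - b * y) - (y * b - b * y) * x) := by
      noncomm_ring
    rw [jacobi]
    exact add_mem (Submodule.subset_span ⟨_, _, bracket_sa hx, hy, rfl⟩)
      (Submodule.subset_span ⟨_, _, hx, bracket_sa hy, rfl⟩)
  | zero => simp
  | add x y _ _ hx hy =>
    convert add_mem hx hy using 1
    noncomm_ring
  | smul r x _ hx =>
    convert Submodule.smul_mem _ r hx using 1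
    simp [smul_sub]

/-- Jordan products of elements of `[A_sa, A_sa]` lie in `M`. -/
theorem jordan_mem_Msub {A : Type*} [CStarAlgebra A] {a c : A} (ha : a ∈ commSA A)
    (hc : c ∈ commSA A) : a * c + c * a ∈ Msub A := by
  have sq_mem {x : A} (hx : x ∈ commSA A) : x ^ 2 ∈ Msub A :=
    AddSubgroup.subset_closure ⟨x, hx, rfl⟩
  convert sub_mem (sub_mem (sq_mem (add_mem ha hc)) (sq_mem ha)) (sq_mem hc) using 1
  noncomm_ring

/-- `[M, iA_sa] ⊆ M`. -/
theorem Msub_bracket_skew {A : Type*} [CStarAlgebra A] {m b : A} (hm : m ∈ Msub A)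
    (hb : star b = -b) : m * b - b * m ∈ Msub A := by
  unfold Msub at hm
  induction hm using AddSubgroup.closure_induction with
  | mem z hz =>
    obtain ⟨a, ha, rfl⟩ := hz
    convert jordan_mem_Msub ha (commSA_bracket_skew ha hb) using 1
    noncomm_ring
  | zero => simp
  | add x y _ _ hx hy =>
    convert add_mem hx hy using 1
    noncomm_ring
  | neg x _ hx =>
    convert neg_mem hx using 1
    noncomm_ring

/-- Every element is `b + ic` with `b` and `c` skew-adjoint. -/
theorem exists_skew_add_I_smul_skew {A : Type*} [CStarAlgebra A] (a : A) :
    ∃ b c : A, star b = -b ∧ star c = -c ∧ a = b + Complex.I • c := by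
  refine ⟨Complex.I • (imaginaryPart a : A), -(Complex.I • (realPart a : A)), ?_, ?_, ?_⟩
  · simp [star_smul, (imaginaryPart a).2.star_eq]
  · simp [star_smul, (realPart a).2.star_eq]
  · conv_lhs => rw [← realPart_add_I_smul_imaginaryPart a]
    rw [smul_neg, smul_smul, Complex.I_mul_I, neg_one_smul, neg_neg, add_comm]

/-- `[M, iA_sa] ⊆ M`, and consequently `L = M + iM` is a Lie ideal of `A`:
`[L, A] ⊆ L`. -/
theorem M_bracket_skew_sub_and_L_lie_ideal (A : Type*) [CStarAlgebra A] :
    (∀ m ∈ Msub A, ∀ b : A, star b = -b → m * b - b * m ∈ Msub A) ∧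
    (∀ l ∈ Lset A, ∀ a : A, l * a - a * l ∈ Lset A) := by
  refine ⟨fun m hm b hb => Msub_bracket_skew hm hb, ?_⟩
  rintro _ ⟨m, hm, m', hm', rfl⟩ a
  obtain ⟨b, c, hb, hc, rfl⟩ := exists_skew_add_I_smul_skew a
  refine ⟨_, sub_mem (Msub_bracket_skew hm hb) (Msub_bracket_skew hm' hc),
    _, add_mem (Msub_bracket_skew hm' hb) (Msub_bracket_skew hm hc), ?_⟩
  simp only [add_mul, mul_add, smul_mul_assoc, mul_smul_comm, smul_add, smul_sub, smul_smul,
    Complex.I_mul_I, neg_one_smul]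
  abel
end
end
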